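/- arXiv:1201.2015 — 2 statements merged into one kernel-verified Lean document; each statement's English description precedes it below -/
import Mathlib

section
/- For real A, B > 0, the function φ(z) = A·Log((1+z)/(1−z)) + B·z/(1+z)² (the case c = 2 of the slit mapping) is injective on 𝔻, and φ(𝔻) = ℂ \ { x ± (Aπ/2)i : x ∈ ℝ, x ≥ −(A/2)·log(2A/B) + (2A+B)/4 }, i.e. the complex plane minus the two horizontal half-lines extending to +∞ at heights ±Aπ/2 with left endpoint −(A/2)·log(2A/B) + (2A+B)/4. -/
open Complex Set
open scoped Real

noncomputable section

/-- The open unit disk in the complex plane. -/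
def unitDisk : Set ℂ := Metric.ball 0 1

/-- A set is convex in the horizontal direction (CHD) if its intersection with
every horizontal line is connected (possibly empty). -/
def IsCHD (Ω : Set ℂ) : Prop := ∀ t : ℝ, IsPreconnected {z | z ∈ Ω ∧ z.im = t}

/-- Integral of `f` along the line segment from `0` to `z`. -/
def segInt (f : ℂ → ℂ) (z : ℂ) : ℂ := ∫ t in (0:ℝ)..1, z * f ((t : ℂ) * z)

/-- Pochhammer symbol `(a)_m = a (a+1) ⋯ (a+m-1)`. -/
def poch (a : ℂ) (m : ℕ) : ℂ := ∏ i ∈ Finset.range m, (a + i)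

/-- Appell's first hypergeometric function `F₁(a, b₁, b₂; c; x, y)`. -/
def appellF1 (a b₁ b₂ c x y : ℂ) : ℂ :=
  ∑' (k : ℕ) (l : ℕ),
    poch a (k + l) * poch b₁ k * poch b₂ l /
      (poch c (k + l) * (Nat.factorial k : ℂ) * (Nat.factorial l : ℂ)) * x ^ k * y ^ l

/-- The function `A s + (B / 4) (1 - exp (-2 s))`, which is the slit mapping in the logarithmic
coordinate `s = log ((1 + z) / (1 - z))`. -/
def stripMap (A B : ℝ) (s : ℂ) : ℂ := A * s + B / 4 * (1 - exp (-(2 * s)))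

/-- The horizontal strip `|Im s| < π / 2`. -/
def halfPiStrip : Set ℂ := {s | -(π / 2) < s.im ∧ s.im < π / 2}

/-- The real part of `stripMap A B` at the point of height `y` whose image has height `v`. -/
def levelRe (A B v y : ℝ) : ℝ :=
  B / 4 - A / 2 * Real.log (4 / B * ((v - A * y) / Real.sin (2 * y)))
    - (v - A * y) / Real.sin (2 * y) * Real.cos (2 * y)

theorem stripMap_im (A B : ℝ) (s : ℂ) :
    (stripMap A B s).im =
      A * s.im + B / 4 * (Real.exp (-(2 * s.re)) * Real.sin (2 * s.im)) := by
  have h : ((B : ℂ) / 4) = ((B / 4 : ℝ) : ℂ) := by push_cast; rfl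
  rw [stripMap, h]
  simp [exp_im, Real.sin_neg]

theorem stripMap_re (A B : ℝ) (s : ℂ) :
    (stripMap A B s).re =
      A * s.re + B / 4 * (1 - Real.exp (-(2 * s.re)) * Real.cos (2 * s.im)) := by
  have h : ((B : ℂ) / 4) = ((B / 4 : ℝ) : ℂ) := by push_cast; rfl
  rw [stripMap, h]
  simp [exp_re, Real.cos_neg]

theorem stripMap_conj (A B : ℝ) (s : ℂ) :
    stripMap A B (starRingEnd ℂ s) = starRingEnd ℂ (stripMap A B s) := by
  apply Complex.ext
  · simp [stripMap_re]
  · simp [stripMap_im]; ring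

theorem sin_two_mul_pos_of_lt_pi_div_two {y : ℝ} (h0 : 0 < y) (h1 : y < π / 2) :
    0 < Real.sin (2 * y) :=
  Real.sin_pos_of_pos_of_lt_pi (by linarith) (by linarith)

theorem mul_im_lt_stripMap_im {A B : ℝ} (hB : 0 < B) {s : ℂ} (h0 : 0 < s.im)
    (h1 : s.im < π / 2) : A * s.im < (stripMap A B s).im := by
  have := sin_two_mul_pos_of_lt_pi_div_two h0 h1
  rw [stripMap_im]
  have : 0 < B / 4 * (Real.exp (-(2 * s.re)) * Real.sin (2 * s.im)) := by positivity
  linarith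

theorem exp_neg_two_mul_re_eq {A B : ℝ} (hB : 0 < B) {s : ℂ} (h0 : 0 < s.im)
    (h1 : s.im < π / 2) :
    Real.exp (-(2 * s.re)) =
      4 / B * (((stripMap A B s).im - A * s.im) / Real.sin (2 * s.im)) := by
  have := sin_two_mul_pos_of_lt_pi_div_two h0 h1
  rw [stripMap_im]
  field_simp
  ring

theorem stripMap_re_eq_levelRe {A B : ℝ} (hB : 0 < B) {s : ℂ} (h0 : 0 < s.im)
    (h1 : s.im < π / 2) :
    (stripMap A B s).re = levelRe A B (stripMap A B s).im s.im := by
  have h := exp_neg_two_mul_re_eq (A := A) hB h0 h1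
  have h' : ((stripMap A B s).im - A * s.im) / Real.sin (2 * s.im)
      = B / 4 * Real.exp (-(2 * s.re)) := by rw [h]; field_simp
  rw [levelRe, ← h, h', Real.log_exp, stripMap_re]
  ring

theorem exists_stripMap_eq_of_levelRe {A B v y : ℝ} (hB : 0 < B) (h0 : 0 < y) (h1 : y < π / 2)
    (hv : A * y < v) :
    ∃ s : ℂ, s.im = y ∧ stripMap A B s = ⟨levelRe A B v y, v⟩ := by
  have hs := sin_two_mul_pos_of_lt_pi_div_two h0 h1
  have ht : 0 < v - A * y := by linarith
  let x : ℝ := -(1 / 2) * Real.log (4 / B * ((v - A * y) / Real.sin (2 * y)))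
  have hx : Real.exp (-(2 * x)) = 4 / B * ((v - A * y) / Real.sin (2 * y)) := by
    have : -(2 * x) = Real.log (4 / B * ((v - A * y) / Real.sin (2 * y))) := by
      simp only [x]; ring
    rw [this, Real.exp_log (by positivity)]
  have him : (stripMap A B ⟨x, y⟩).im = v := by
    rw [stripMap_im, hx]
    change A * y + B / 4 * (4 / B * ((v - A * y) / Real.sin (2 * y)) * Real.sin (2 * y)) = v
    generalize Real.sin (2 * y) = σ at *
    field_simp
    ring
  refine ⟨⟨x, y⟩, rfl, Complex.ext ?_ him⟩
  rw [stripMap_re_eq_levelRe hB h0 h1, him]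

theorem hasDerivAt_levelRe {A B v y : ℝ} (hB : 0 < B) (h0 : 0 < y) (h1 : y < π / 2)
    (hv : A * y < v) :
    HasDerivAt (levelRe A B v)
      (((A + 2 * ((v - A * y) / Real.sin (2 * y)) * Real.cos (2 * y)) ^ 2
        + 4 * (v - A * y) ^ 2) / (2 * (v - A * y))) y := by
  have hs := sin_two_mul_pos_of_lt_pi_div_two h0 h1
  have ht : 0 < v - A * y := by linarith
  have h2 : HasDerivAt (fun y : ℝ => 2 * y) 2 y := by
    simpa using (hasDerivAt_id y).const_mul 2
  have ht' : HasDerivAt (fun y : ℝ => v - A * y) (-A) y := by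
    simpa using ((hasDerivAt_id y).const_mul A).const_sub v
  have hr := ht'.fun_div h2.sin hs.ne'
  have hl := ((hr.const_mul (4 / B)).log (by positivity)).const_mul (A / 2)
  refine ((hl.const_sub (B / 4)).sub (hr.mul h2.cos)).congr_deriv ?_
  generalize v - A * y = t at *
  generalize Real.sin (2 * y) = σ at *
  generalize Real.cos (2 * y) = c at *
  field_simp
  ring

theorem strictMonoOn_levelRe {A B v b : ℝ} (hB : 0 < B) (hb : b ≤ π / 2)
    (hv : ∀ y < b, A * y < v) : StrictMonoOn (levelRe A B v) (Ioo 0 b) := by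
  have hd : ∀ y ∈ Ioo 0 b, _ := fun y hy =>
    hasDerivAt_levelRe (A := A) hB hy.1 (hy.2.trans_le hb) (hv y hy.2)
  apply strictMonoOn_of_hasDerivWithinAt_pos (convex_Ioo 0 b)
    (fun y hy => (hd y hy).continuousAt.continuousWithinAt)
  · intro y hy
    rw [interior_Ioo] at hy
    exact (hd y hy).hasDerivWithinAt
  · intro y hy
    rw [interior_Ioo] at hy
    have : 0 < v - A * y := by linarith [hv y hy.2]
    positivity

theorem continuousOn_levelRe {A B v b : ℝ} (hB : 0 < B) (hb : b ≤ π / 2)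
    (hv : ∀ y < b, A * y < v) : ContinuousOn (levelRe A B v) (Ioo 0 b) := fun y hy =>
  (hasDerivAt_levelRe (A := A) hB hy.1 (hy.2.trans_le hb)
    (hv y hy.2)).continuousAt.continuousWithinAt

open Filter Topology

theorem tendsto_sin_two_mul_nhdsGT_zero :
    Tendsto (fun y : ℝ => Real.sin (2 * y)) (𝓝[>] 0) (𝓝[>] 0) := by
  refine tendsto_nhdsWithin_iff.2 ⟨?_, ?_⟩
  · exact (Continuous.tendsto' (by fun_prop) _ _ (by simp)).mono_left nhdsWithin_le_nhds
  · filter_upwards [Ioo_mem_nhdsGT (show (0 : ℝ) < π / 2 by positivity)] with y hy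
    exact sin_two_mul_pos_of_lt_pi_div_two hy.1 hy.2

theorem tendsto_sin_two_mul_nhdsLT_pi_div_two :
    Tendsto (fun y : ℝ => Real.sin (2 * y)) (𝓝[<] (π / 2)) (𝓝[>] 0) := by
  refine tendsto_nhdsWithin_iff.2 ⟨?_, ?_⟩
  · exact (Continuous.tendsto' (by fun_prop) _ _ (by
      rw [mul_div_cancel₀ _ two_ne_zero, Real.sin_pi])).mono_left nhdsWithin_le_nhds
  · filter_upwards [Ioo_mem_nhdsLT (show (0 : ℝ) < π / 2 by positivity)] with y hy
    exact sin_two_mul_pos_of_lt_pi_div_two hy.1 hy.2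

theorem tendsto_levelRe_nhdsGT_zero {A B v : ℝ} (hA : 0 < A) (hB : 0 < B) (hv : 0 < v) :
    Tendsto (levelRe A B v) (𝓝[>] 0) atBot := by
  have ht : Tendsto (fun y : ℝ => v - A * y) (𝓝[>] 0) (𝓝 v) :=
    (Continuous.tendsto' (by fun_prop) _ _ (by simp)).mono_left nhdsWithin_le_nhds
  have hc : Tendsto (fun y : ℝ => Real.cos (2 * y)) (𝓝[>] 0) (𝓝 1) :=
    (Continuous.tendsto' (by fun_prop) _ _ (by simp)).mono_left nhdsWithin_le_nhds
  have hr : Tendsto (fun y : ℝ => (v - A * y) / Real.sin (2 * y)) (𝓝[>] 0) atTop :=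
    ht.pos_mul_atTop hv tendsto_sin_two_mul_nhdsGT_zero.inv_tendsto_nhdsGT_zero
  have hl := (Real.tendsto_log_atTop.comp
    (hr.const_mul_atTop (show 0 < 4 / B by positivity))).const_mul_atTop (half_pos hA)
  have h1 := tendsto_const_nhds (x := B / 4).add_atBot (tendsto_neg_atTop_atBot.comp hl)
  have h2 := h1.atBot_add_atBot (tendsto_neg_atTop_atBot.comp (hr.atTop_mul_pos one_pos hc))
  refine h2.congr fun y => ?_
  simp only [levelRe, Function.comp]
  ring

theorem tendsto_levelRe_nhdsLT_of_lt {A B v : ℝ} (hA : 0 < A) (hB : 0 < B) (hv : 0 < v)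
    (hv' : v < A * π / 2) :
    Tendsto (levelRe A B v) (𝓝[<] (v / A)) atTop := by
  have hlt : v / A < π / 2 := by rw [div_lt_iff₀ hA]; linarith
  have hs := sin_two_mul_pos_of_lt_pi_div_two (div_pos hv hA) hlt
  have hr : Tendsto (fun y : ℝ => (v - A * y) / Real.sin (2 * y)) (𝓝[<] (v / A)) (𝓝 0) := by
    have : ContinuousAt (fun y : ℝ => (v - A * y) / Real.sin (2 * y)) (v / A) :=
      ContinuousAt.div (by fun_prop) (by fun_prop) hs.ne'
    refine Tendsto.mono_left ?_ nhdsWithin_le_nhds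
    convert this.tendsto using 2
    field_simp
    simp
  have hr' : Tendsto (fun y : ℝ => 4 / B * ((v - A * y) / Real.sin (2 * y)))
      (𝓝[<] (v / A)) (𝓝[>] 0) := by
    refine tendsto_nhdsWithin_iff.2 ⟨by simpa using hr.const_mul (4 / B), ?_⟩
    filter_upwards [Ioo_mem_nhdsLT (div_pos hv hA)] with y hy
    have h1 := sin_two_mul_pos_of_lt_pi_div_two hy.1 (hy.2.trans hlt)
    have h2 : 0 < v - A * y := by have := (lt_div_iff₀ hA).1 hy.2; linarith
    simp only [mem_Ioi]
    positivity
  have hc : Tendsto (fun y : ℝ => Real.cos (2 * y)) (𝓝[<] (v / A)) (𝓝 (Real.cos (2 * (v / A)))) :=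
    (Continuous.tendsto (by fun_prop) _).mono_left nhdsWithin_le_nhds
  have hl := (Real.tendsto_log_nhdsGT_zero.comp hr').const_mul_atBot (half_pos hA)
  have h1 := tendsto_const_nhds (x := B / 4).add_atTop (tendsto_neg_atBot_atTop.comp hl)
  refine (h1.atTop_add (hr.mul hc).neg).congr fun y => ?_
  simp only [levelRe, Function.comp]
  ring

theorem tendsto_levelRe_nhdsLT_of_gt {A B v : ℝ} (hB : 0 < B) (hv : A * π / 2 < v) :
    Tendsto (levelRe A B v) (𝓝[<] (π / 2)) atTop := by
  have ht : Tendsto (fun y : ℝ => v - A * y) (𝓝[<] (π / 2)) (𝓝 (v - A * (π / 2))) :=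
    (Continuous.tendsto (by fun_prop) _).mono_left nhdsWithin_le_nhds
  have hc : Tendsto (fun y : ℝ => Real.cos (2 * y)) (𝓝[<] (π / 2)) (𝓝 (-1)) :=
    (Continuous.tendsto' (by fun_prop) _ _ (by
      rw [mul_div_cancel₀ _ two_ne_zero, Real.cos_pi])).mono_left nhdsWithin_le_nhds
  have hr : Tendsto (fun y : ℝ => 4 / B * ((v - A * y) / Real.sin (2 * y)))
      (𝓝[<] (π / 2)) atTop :=
    (ht.pos_mul_atTop (by linarith)
      tendsto_sin_two_mul_nhdsLT_pi_div_two.inv_tendsto_nhdsGT_zero).const_mul_atTop (by positivity)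
  have hq : Tendsto (fun y : ℝ => Real.log (4 / B * ((v - A * y) / Real.sin (2 * y))) /
      (4 / B * ((v - A * y) / Real.sin (2 * y)))) (𝓝[<] (π / 2)) (𝓝 0) :=
    (Real.isLittleO_log_id_atTop.tendsto_div_nhds_zero).comp hr
  have hk : Tendsto (fun y : ℝ => -(A / 2 * (Real.log (4 / B * ((v - A * y) / Real.sin (2 * y))) /
      (4 / B * ((v - A * y) / Real.sin (2 * y))))) - B / 4 * Real.cos (2 * y))
      (𝓝[<] (π / 2)) (𝓝 (B / 4)) := by
    simpa using (hq.const_mul (A / 2)).neg.sub (hc.const_mul (B / 4))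
  refine (tendsto_const_nhds (x := B / 4).add_atTop
    (hr.atTop_mul_pos (by positivity) hk)).congr' ?_
  filter_upwards [hr.eventually_gt_atTop 0] with y hy
  have hq' : (v - A * y) / Real.sin (2 * y)
      = B / 4 * (4 / B * ((v - A * y) / Real.sin (2 * y))) := by field_simp
  rw [levelRe]
  generalize 4 / B * ((v - A * y) / Real.sin (2 * y)) = q at *
  rw [hq']
  field_simp
  ring

theorem tendsto_levelRe_nhdsLT_of_eq {A B : ℝ} (hA : 0 < A) (hB : 0 < B) :
    Tendsto (levelRe A B (A * π / 2)) (𝓝[<] (π / 2))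
      (𝓝 (-(A / 2 * Real.log (2 * A / B)) + (2 * A + B) / 4)) := by
  have hc : Tendsto (fun y : ℝ => Real.cos (2 * y)) (𝓝[<] (π / 2)) (𝓝 (-1)) :=
    (Continuous.tendsto' (by fun_prop) _ _ (by
      rw [mul_div_cancel₀ _ two_ne_zero, Real.cos_pi])).mono_left nhdsWithin_le_nhds
  have hsinc : Tendsto (fun y : ℝ => A / 2 / Real.sinc (π - 2 * y)) (𝓝[<] (π / 2))
      (𝓝 (A / 2)) := by
    have h : Tendsto (fun y : ℝ => Real.sinc (π - 2 * y)) (𝓝 (π / 2)) (𝓝 1) :=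
      (Real.continuous_sinc.comp (by fun_prop : Continuous fun y : ℝ => π - 2 * y)).tendsto' _ _ (by
        simp [mul_div_cancel₀])
    have h' := (tendsto_const_nhds (x := A / 2)).div h one_ne_zero
    rw [div_one] at h'
    exact h'.mono_left nhdsWithin_le_nhds
  have hr : Tendsto (fun y : ℝ => (A * π / 2 - A * y) / Real.sin (2 * y)) (𝓝[<] (π / 2))
      (𝓝 (A / 2)) := by
    refine hsinc.congr' ?_
    filter_upwards [self_mem_nhdsWithin] with y hy
    have : π - 2 * y ≠ 0 := by have := mem_Iio.1 hy; linarith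
    rw [Real.sinc_of_ne_zero this, Real.sin_pi_sub, div_div_eq_mul_div]
    ring
  have hl := (((hr.const_mul (4 / B)).log (by positivity)).const_mul (A / 2)).const_sub (B / 4)
  have h := hl.sub (hr.mul hc)
  have e : 4 / B * (A / 2) = 2 * A / B := by ring
  rw [e] at h
  have e' : -(A / 2 * Real.log (2 * A / B)) + (2 * A + B) / 4
      = B / 4 - A / 2 * Real.log (2 * A / B) - A / 2 * -1 := by ring
  rw [e']
  exact h

theorem levelRe_image_of_lt {A B v : ℝ} (hA : 0 < A) (hB : 0 < B) (hv : 0 < v)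
    (hv' : v < A * π / 2) : levelRe A B v '' Ioo 0 (v / A) = univ := by
  have hpos := div_pos hv hA
  have := left_nhdsWithin_Ioo_neBot hpos
  have := right_nhdsWithin_Ioo_neBot hpos
  refine eq_univ_of_univ_subset (isPreconnected_Ioo.intermediate_value_Iii
    (l₁ := 𝓝[Ioo 0 (v / A)] 0) (l₂ := 𝓝[Ioo 0 (v / A)] (v / A))
    inf_le_right inf_le_right (continuousOn_levelRe hB ?_ ?_) ?_ ?_)
  · rw [div_le_iff₀ hA]; linarith
  · intro y hy
    have := (lt_div_iff₀ hA).1 hy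
    linarith
  · exact (tendsto_levelRe_nhdsGT_zero hA hB hv).mono_left (nhdsWithin_mono _ Ioo_subset_Ioi_self)
  · exact (tendsto_levelRe_nhdsLT_of_lt hA hB hv hv').mono_left
      (nhdsWithin_mono _ Ioo_subset_Iio_self)

theorem levelRe_image_of_gt {A B v : ℝ} (hA : 0 < A) (hB : 0 < B) (hv : A * π / 2 < v) :
    levelRe A B v '' Ioo 0 (π / 2) = univ := by
  have hpos : 0 < π / 2 := by positivity
  have := left_nhdsWithin_Ioo_neBot hpos
  have := right_nhdsWithin_Ioo_neBot hpos
  refine eq_univ_of_univ_subset (isPreconnected_Ioo.intermediate_value_Iii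
    (l₁ := 𝓝[Ioo 0 (π / 2)] 0) (l₂ := 𝓝[Ioo 0 (π / 2)] (π / 2))
    inf_le_right inf_le_right (continuousOn_levelRe hB le_rfl ?_) ?_ ?_)
  · intro y hy
    nlinarith
  · exact (tendsto_levelRe_nhdsGT_zero hA hB (lt_trans (by positivity) hv)).mono_left
      (nhdsWithin_mono _ Ioo_subset_Ioi_self)
  · exact (tendsto_levelRe_nhdsLT_of_gt hB hv).mono_left (nhdsWithin_mono _ Ioo_subset_Iio_self)

theorem levelRe_image_of_eq {A B : ℝ} (hA : 0 < A) (hB : 0 < B) :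
    levelRe A B (A * π / 2) '' Ioo 0 (π / 2) =
      Iio (-(A / 2 * Real.log (2 * A / B)) + (2 * A + B) / 4) := by
  have hpos : 0 < π / 2 := by positivity
  have := left_nhdsWithin_Ioo_neBot hpos
  have := right_nhdsWithin_Ioo_neBot hpos
  have hv : ∀ y < π / 2, A * y < A * π / 2 := fun y hy => by nlinarith
  have hlim := tendsto_levelRe_nhdsLT_of_eq hA hB
  apply Subset.antisymm
  · rintro _ ⟨y, hy, rfl⟩
    have hmono := strictMonoOn_levelRe hB le_rfl hv
    obtain ⟨y', hy', hy''⟩ := exists_between hy.2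
    have hmem : y' ∈ Ioo 0 (π / 2) := ⟨hy.1.trans hy', hy''⟩
    refine (hmono hy hmem hy').trans_le (ge_of_tendsto hlim ?_)
    filter_upwards [Ioo_mem_nhdsLT hy''] with x hx
    exact (hmono hmem ⟨hmem.1.trans hx.1, hx.2⟩ hx.1).le
  · refine isPreconnected_Ioo.intermediate_value_Iio (l₁ := 𝓝[Ioo 0 (π / 2)] 0)
      (l₂ := 𝓝[Ioo 0 (π / 2)] (π / 2)) inf_le_right inf_le_right
      (continuousOn_levelRe hB le_rfl hv) ?_ ?_
    · exact (tendsto_levelRe_nhdsGT_zero hA hB (by positivity)).mono_left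
        (nhdsWithin_mono _ Ioo_subset_Ioi_self)
    · exact hlim.mono_left (nhdsWithin_mono _ Ioo_subset_Iio_self)

theorem stripMap_im_pos {A B : ℝ} (hA : 0 < A) (hB : 0 < B) {s : ℂ} (h0 : 0 < s.im)
    (h1 : s.im < π / 2) : 0 < (stripMap A B s).im :=
  (mul_pos hA h0).trans (mul_im_lt_stripMap_im hB h0 h1)

theorem stripMap_im_neg {A B : ℝ} (hA : 0 < A) (hB : 0 < B) {s : ℂ} (h0 : s.im < 0)
    (h1 : -(π / 2) < s.im) : (stripMap A B s).im < 0 := by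
  have := stripMap_im_pos hA hB (s := starRingEnd ℂ s) (by simpa using h0)
    (by rw [conj_im]; linarith)
  simpa [stripMap_conj] using this

theorem stripMap_im_zero {A B : ℝ} {s : ℂ} (h : s.im = 0) : (stripMap A B s).im = 0 := by
  simp [stripMap_im, h]

theorem sign_im_stripMap {A B : ℝ} (hA : 0 < A) (hB : 0 < B) {s : ℂ} (hs : s ∈ halfPiStrip) :
    SignType.sign (stripMap A B s).im = SignType.sign s.im := by
  rcases lt_trichotomy s.im 0 with h | h | h
  · rw [sign_neg h, sign_neg (stripMap_im_neg hA hB h hs.1)]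
  · rw [h, stripMap_im_zero h]
  · rw [sign_pos h, sign_pos (stripMap_im_pos hA hB h hs.2)]

theorem stripMap_injective_of_im_pos {A B : ℝ} (hA : 0 < A) (hB : 0 < B) {s t : ℂ}
    (hs : 0 < s.im) (hs' : s.im < π / 2) (ht : 0 < t.im) (ht' : t.im < π / 2)
    (h : stripMap A B s = stripMap A B t) : s = t := by
  have hsv := mul_im_lt_stripMap_im (A := A) hB hs hs'
  have htv := mul_im_lt_stripMap_im (A := A) hB ht ht'
  rw [h] at hsv
  have hmono : StrictMonoOn (levelRe A B (stripMap A B t).im)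
      (Ioo 0 (min (π / 2) ((stripMap A B t).im / A))) := by
    refine strictMonoOn_levelRe hB (min_le_left _ _) fun y hy => ?_
    have := (lt_div_iff₀ hA).1 (hy.trans_le (min_le_right _ _))
    linarith
  have him : s.im = t.im := by
    refine hmono.injOn ⟨hs, lt_min hs' ?_⟩ ⟨ht, lt_min ht' ?_⟩ ?_
    · rw [lt_div_iff₀ hA]; linarith
    · rw [lt_div_iff₀ hA]; linarith
    · rw [← stripMap_re_eq_levelRe hB ht ht', ← h, ← stripMap_re_eq_levelRe hB hs hs']
  refine Complex.ext ?_ him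
  have h1 := exp_neg_two_mul_re_eq (A := A) hB hs hs'
  rw [h, him, ← exp_neg_two_mul_re_eq hB ht ht', Real.exp_eq_exp] at h1
  linarith

/-- The restriction of `stripMap A B` to the real axis. -/
def realStripMap (A B x : ℝ) : ℝ := A * x + B / 4 * (1 - Real.exp (-(2 * x)))

theorem strictMono_realStripMap {A B : ℝ} (hA : 0 < A) (hB : 0 < B) :
    StrictMono (realStripMap A B) := by
  intro x y h
  have : Real.exp (-(2 * y)) < Real.exp (-(2 * x)) := Real.exp_lt_exp.2 (by linarith)
  rw [realStripMap, realStripMap]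
  gcongr

theorem surjective_realStripMap {A B : ℝ} (hA : 0 < A) (hB : 0 < B) :
    Function.Surjective (realStripMap A B) := by
  refine Continuous.surjective (by unfold realStripMap; fun_prop) ?_ ?_
  · have he : Tendsto (fun x : ℝ => Real.exp (-(2 * x))) atTop (𝓝 0) :=
      Real.tendsto_exp_neg_atTop_nhds_zero.comp (tendsto_id.const_mul_atTop two_pos)
    exact (tendsto_id.const_mul_atTop hA).atTop_add ((he.const_sub 1).const_mul (B / 4))
  · refine tendsto_atBot_mono' atBot ?_
      (tendsto_const_nhds (x := B / 4).add_atBot (tendsto_id.const_mul_atBot hA))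
    refine Eventually.of_forall fun x => ?_
    have : 0 < B / 4 * Real.exp (-(2 * x)) := by positivity
    simp only [realStripMap, id]
    linarith

theorem stripMap_re_of_im_eq_zero {A B : ℝ} {s : ℂ} (h : s.im = 0) :
    (stripMap A B s).re = realStripMap A B s.re := by
  simp [stripMap_re, realStripMap, h]

theorem conj_mem_halfPiStrip {s : ℂ} (hs : s ∈ halfPiStrip) :
    starRingEnd ℂ s ∈ halfPiStrip := by
  simp only [halfPiStrip, mem_ofPred_eq, conj_im] at *
  constructor <;> linarith

theorem injOn_stripMap {A B : ℝ} (hA : 0 < A) (hB : 0 < B) :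
    InjOn (stripMap A B) halfPiStrip := by
  intro s hs t ht h
  have hsign : SignType.sign s.im = SignType.sign t.im := by
    rw [← sign_im_stripMap hA hB hs, h, sign_im_stripMap hA hB ht]
  rcases lt_trichotomy s.im 0 with h0 | h0 | h0
  · have h0' : t.im < 0 := by rwa [sign_neg h0, eq_comm, sign_eq_neg_one_iff] at hsign
    apply (starRingEnd ℂ).injective
    refine stripMap_injective_of_im_pos hA hB (by simpa using h0) (conj_mem_halfPiStrip hs).2
      (by simpa using h0') (conj_mem_halfPiStrip ht).2 ?_
    rw [stripMap_conj, stripMap_conj, h]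
  · have h0' : t.im = 0 := by rwa [h0, sign_zero, eq_comm, sign_eq_zero_iff] at hsign
    refine Complex.ext ((strictMono_realStripMap hA hB).injective ?_) (h0.trans h0'.symm)
    rw [← stripMap_re_of_im_eq_zero h0, ← stripMap_re_of_im_eq_zero h0', h]
  · have h0' : 0 < t.im := by rwa [sign_pos h0, eq_comm, sign_eq_one_iff] at hsign
    exact stripMap_injective_of_im_pos hA hB h0 hs.2 h0' ht.2 h

/-- The two horizontal half-lines omitted by the slit mapping. -/
def slits (A B : ℝ) : Set ℂ :=
  {w : ℂ | (w.im = A * Real.pi / 2 ∨ w.im = -(A * Real.pi / 2)) ∧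
    -(A / 2 * Real.log (2 * A / B)) + (2 * A + B) / 4 ≤ w.re}

theorem conj_mem_slits {A B : ℝ} {w : ℂ} : starRingEnd ℂ w ∈ slits A B ↔ w ∈ slits A B := by
  simp only [slits, mem_ofPred_eq, conj_im, conj_re, neg_eq_iff_eq_neg, neg_neg]
  rw [or_comm]

theorem exists_stripMap_eq_of_im_pos {A B : ℝ} (hA : 0 < A) (hB : 0 < B) {w : ℂ}
    (hw : 0 < w.im) (hslit : w ∉ slits A B) : ∃ s ∈ halfPiStrip, stripMap A B s = w := by
  obtain ⟨y, h0, h1, hv, hy⟩ : ∃ y : ℝ, 0 < y ∧ y < π / 2 ∧ A * y < w.im ∧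
      levelRe A B w.im y = w.re := by
    rcases lt_trichotomy w.im (A * π / 2) with h | h | h
    · obtain ⟨y, hy, e⟩ := (levelRe_image_of_lt hA hB hw h).ge (mem_univ w.re)
      have h2 := (lt_div_iff₀ hA).1 hy.2
      exact ⟨y, hy.1, by nlinarith, by linarith, e⟩
    · have hlt : w.re < -(A / 2 * Real.log (2 * A / B)) + (2 * A + B) / 4 := by
        by_contra hc
        exact hslit ⟨Or.inl h, not_lt.1 hc⟩
      obtain ⟨y, hy, e⟩ := (levelRe_image_of_eq hA hB).ge hlt
      exact ⟨y, hy.1, hy.2, by nlinarith [hy.2], by rw [h, e]⟩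
    · obtain ⟨y, hy, e⟩ := (levelRe_image_of_gt hA hB h).ge (mem_univ w.re)
      exact ⟨y, hy.1, hy.2, by nlinarith [hy.2], e⟩
  obtain ⟨s, rfl, e⟩ := exists_stripMap_eq_of_levelRe hB h0 h1 hv
  exact ⟨s, ⟨by linarith, h1⟩, by rw [e, hy]⟩

theorem stripMap_notMem_slits_of_im_pos {A B : ℝ} (hA : 0 < A) (hB : 0 < B) {s : ℂ}
    (h0 : 0 < s.im) (h1 : s.im < π / 2) : stripMap A B s ∉ slits A B := by
  rintro ⟨h | h, hre⟩
  · have := (levelRe_image_of_eq hA hB).le (mem_image_of_mem _ ⟨h0, h1⟩)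
    rw [← h, ← stripMap_re_eq_levelRe hB h0 h1] at this
    exact not_le.2 this hre
  · have := stripMap_im_pos hA hB h0 h1
    have : 0 < A * π := by positivity
    linarith

theorem image_stripMap {A B : ℝ} (hA : 0 < A) (hB : 0 < B) :
    stripMap A B '' halfPiStrip = (slits A B)ᶜ := by
  apply Subset.antisymm
  · rintro _ ⟨s, hs, rfl⟩
    rcases lt_trichotomy s.im 0 with h0 | h0 | h0
    · have := stripMap_notMem_slits_of_im_pos hA hB (s := starRingEnd ℂ s)
        (by simpa using h0) (conj_mem_halfPiStrip hs).2
      rwa [stripMap_conj, conj_mem_slits] at this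
    · rintro ⟨h, -⟩
      rw [stripMap_im_zero h0] at h
      have : 0 < A * π := by positivity
      rcases h with h | h <;> linarith
    · exact stripMap_notMem_slits_of_im_pos hA hB h0 hs.2
  · intro w hw
    rcases lt_trichotomy w.im 0 with h0 | h0 | h0
    · obtain ⟨s, hs, e⟩ := exists_stripMap_eq_of_im_pos hA hB (w := starRingEnd ℂ w)
        (by simpa using h0) (by rwa [conj_mem_slits])
      exact ⟨_, conj_mem_halfPiStrip hs, by rw [stripMap_conj, e, conj_conj]⟩
    · obtain ⟨x, hx⟩ := surjective_realStripMap hA hB w.re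
      refine ⟨x, ⟨by simp; positivity, by simp; positivity⟩, Complex.ext ?_ ?_⟩
      · rw [stripMap_re_of_im_eq_zero (ofReal_im x), ofReal_re, hx]
      · rw [stripMap_im_zero (ofReal_im x), h0]
    · exact exists_stripMap_eq_of_im_pos hA hB h0 hw

theorem re_cayley_pos {z : ℂ} (hz : z ∈ unitDisk) : 0 < ((1 + z) / (1 - z)).re := by
  have hz' : ‖z‖ < 1 := by simpa [unitDisk] using hz
  have h1 : 1 - z ≠ 0 := by
    intro h
    rw [← sub_eq_zero.1 h] at hz'
    simp at hz'
  have hsq : z.re * z.re + z.im * z.im < 1 := by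
    rw [← normSq_apply, normSq_eq_norm_sq]
    nlinarith [norm_nonneg z]
  have hpos := normSq_pos.2 h1
  rw [div_re, ← add_div]
  apply div_pos _ hpos
  simp
  nlinarith

theorem bijOn_log_cayley :
    BijOn (fun z : ℂ => log ((1 + z) / (1 - z))) unitDisk halfPiStrip := by
  have hne : ∀ z ∈ unitDisk, 1 - z ≠ 0 := by
    intro z hz h
    have := re_cayley_pos hz
    simp [h] at this
  refine ⟨fun z hz => ?_, fun z hz z' hz' h => ?_, fun s hs => ?_⟩
  · have := abs_lt.1 (abs_arg_lt_pi_div_two_iff.2 (Or.inl (re_cayley_pos hz)))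
    simpa only [halfPiStrip, mem_ofPred_eq, log_im] using this
  · have h0 : ∀ z ∈ unitDisk, (1 + z) / (1 - z) ≠ 0 := fun z hz h => by
      simpa [h] using re_cayley_pos hz
    have := congrArg exp h
    simp only [exp_log (h0 z hz), exp_log (h0 z' hz')] at this
    rw [div_eq_div_iff (hne z hz) (hne z' hz')] at this
    linear_combination this / 2
  · have hre : 0 < (exp s).re := by
      rw [exp_re]
      exact mul_pos (Real.exp_pos _) (Real.cos_pos_of_mem_Ioo hs)
    have h1 : exp s + 1 ≠ 0 := by
      intro h
      have := congrArg re h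
      simp only [add_re, one_re, zero_re] at this
      linarith
    refine ⟨(exp s - 1) / (exp s + 1), ?_, ?_⟩
    · rw [unitDisk, mem_ball_zero_iff, norm_div, div_lt_one (norm_pos_iff.2 h1)]
      apply lt_of_pow_lt_pow_left₀ 2 (norm_nonneg _)
      rw [← normSq_eq_norm_sq, ← normSq_eq_norm_sq, normSq_apply, normSq_apply]
      simp only [add_re, sub_re, add_im, sub_im, one_re, one_im]
      nlinarith
    · have e : (1 + (exp s - 1) / (exp s + 1)) / (1 - (exp s - 1) / (exp s + 1)) = exp s := by
        field_simp
        ring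
      simp only [e]
      exact log_exp (by linarith [hs.1, Real.pi_pos]) (by linarith [hs.2, Real.pi_pos])

theorem slitMap_eq_stripMap {A B : ℝ} {z : ℂ} (hz : z ∈ unitDisk) :
    (A : ℂ) * Complex.log ((1 + z) / (1 - z)) + (B : ℂ) * z / (1 + z) ^ 2 =
      stripMap A B (log ((1 + z) / (1 - z))) := by
  have h := re_cayley_pos hz
  have h0 : (1 + z) / (1 - z) ≠ 0 := fun h' => by simp [h'] at h
  obtain ⟨hp, hm⟩ := div_ne_zero_iff.1 h0
  rw [stripMap, exp_neg, two_mul, exp_add, exp_log h0]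
  field_simp
  ring

theorem slit_mapping_image_c_two
    (A B : ℝ) (hA : 0 < A) (hB : 0 < B) :
    let φ : ℂ → ℂ := fun z =>
      (A : ℂ) * Complex.log ((1 + z) / (1 - z)) + (B : ℂ) * z / (1 + z) ^ 2
    Set.InjOn φ unitDisk ∧
    φ '' unitDisk =
      {w : ℂ | (w.im = A * Real.pi / 2 ∨ w.im = -(A * Real.pi / 2)) ∧
        -(A / 2 * Real.log (2 * A / B)) + (2 * A + B) / 4 ≤ w.re}ᶜ := by
  intro φ
  have hφ : EqOn φ (stripMap A B ∘ fun z : ℂ => log ((1 + z) / (1 - z))) unitDisk :=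
    fun z hz => slitMap_eq_stripMap hz
  constructor
  · exact ((injOn_stripMap hA hB).comp bijOn_log_cayley.injOn bijOn_log_cayley.mapsTo).congr
      hφ.symm
  · rw [hφ.image_eq, image_comp, bijOn_log_cayley.image_eq, image_stripMap hA hB]
    rfl
end
end

section
/- Let A, B > 0, γ ∈ (0, π), and let φ(z) = A·Log((1+z)/(1−z)) + B·z/((1−e^{iγ}z)(1−e^{−iγ}z)) on 𝔻. For a positive integer n, define f(z) = 2 Re[ ∫₀^z φ'(ζ)/(1−ζⁿ) dζ ] − conj(φ(z)), the harmonic shear of φ with dilatation ω(z) = zⁿ. Then f is injective on 𝔻 and f(𝔻) is convex in the horizontal direction. -/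
open Complex Set
open scoped Real

noncomputable section

open Filter Topology

/-- A horizontal shear `Re H + i Im Φ` of an injective holomorphic map `Φ` with connected
horizontal level sets is injective with image convex in the horizontal direction, provided
`H' = P Φ'` with `Re P > 0`. -/
theorem injOn_and_isCHD_of_shear {U : Set ℂ} (hU : IsOpen U) {Φ Φ' H P F : ℂ → ℂ}
    (hΦ : ∀ w ∈ U, HasDerivAt Φ (Φ' w) w) (hΦ' : ∀ w ∈ U, Φ' w ≠ 0)
    (hH : ∀ w ∈ U, HasDerivAt H (P w * Φ' w) w) (hP : ∀ w ∈ U, 0 < (P w).re)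
    (hinj : InjOn Φ U) (hlev : ∀ t : ℝ, IsPreconnected {w | w ∈ U ∧ (Φ w).im = t})
    (hre : ∀ w ∈ U, (F w).re = (H w).re) (him : ∀ w ∈ U, (F w).im = (Φ w).im) :
    InjOn F U ∧ IsCHD (F '' U) := by
  have hΦc : ContinuousOn Φ U := fun w hw => (hΦ w hw).continuousAt.continuousWithinAt
  have hHc : ContinuousOn H U := fun w hw => (hH w hw).continuousAt.continuousWithinAt
  have hFc : ContinuousOn F U := by
    have : ContinuousOn (fun w => ((H w).re : ℂ) + ((Φ w).im : ℂ) * I) U := by fun_prop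
    refine this.congr fun w hw => ?_
    simp only
    rw [← hre w hw, ← him w hw, re_add_im]
  refine ⟨fun w₁ h₁ w₂ h₂ h => ?_, fun t => ?_⟩
  · set t := (Φ w₁).im with ht
    have ht₂ : (Φ w₂).im = t := by rw [← him w₂ h₂, ← h, him w₁ h₁]
    set L := {w | w ∈ U ∧ (Φ w).im = t} with hL
    have hJ : Convex ℝ ((fun w => (Φ w).re) '' L) := by
      refine ((hlev t).image _ ?_).ordConnected.convex
      exact continuous_re.comp_continuousOn (hΦc.mono fun w hw => hw.1)
    have hg : ∀ w ∈ U, HasDerivAt (Function.invFunOn Φ U) (Φ' w)⁻¹ (Φ w) := fun w hw => by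
      have hs : HasStrictDerivAt Φ (Φ' w) w := by
        have : DifferentiableOn ℂ Φ U := fun z hz =>
          (hΦ z hz).differentiableAt.differentiableWithinAt
        have := (this.analyticAt (hU.mem_nhds hw)).hasStrictDerivAt
        rwa [(hΦ w hw).deriv] at this
      exact (hs.to_local_left_inverse (hΦ' w hw)
        (eventually_of_mem (hU.mem_nhds hw) fun x hx => hinj.leftInvOn_invFunOn hx)).hasDerivAt
    have hr : ∀ w ∈ L, HasDerivAt
        (fun u : ℝ => (H (Function.invFunOn Φ U ((u : ℂ) + t * I))).re) (P w).re (Φ w).re := by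
      rintro w ⟨hw, hwt⟩
      have e : ((Φ w).re : ℂ) + t * I = Φ w := by rw [← hwt, re_add_im]
      have hi : Function.invFunOn Φ U (Φ w) = w := hinj.leftInvOn_invFunOn hw
      have hg' := hg w hw
      have h3 : HasDerivAt (fun v : ℂ => v + t * I) 1 ((Φ w).re : ℂ) :=
        (hasDerivAt_id _).add_const _
      rw [← e] at hg'
      have hH' := hH w hw
      rw [← hi, ← e] at hH'
      have h4 := (hH'.comp ((Φ w).re : ℂ) (hg'.comp (h := fun v : ℂ => v + t * I) _ h3)).real_of_complex
      rw [e, hi] at h4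
      refine h4.congr_deriv ?_
      rw [mul_one, mul_assoc, mul_inv_cancel₀ (hΦ' w hw), mul_one]
    have hmono : StrictMonoOn (fun u : ℝ => (H (Function.invFunOn Φ U ((u : ℂ) + t * I))).re)
        ((fun w => (Φ w).re) '' L) := by
      refine strictMonoOn_of_deriv_pos hJ ?_ ?_
      · rintro _ ⟨w, hw, rfl⟩
        exact (hr w hw).continuousAt.continuousWithinAt
      · intro u hu
        obtain ⟨w, hw, rfl⟩ := interior_subset hu
        simp only
        rw [(hr w hw).deriv]
        exact hP w hw.1
    have key : ∀ w ∈ L, (H (Function.invFunOn Φ U (((Φ w).re : ℂ) + t * I))).re = (F w).re := by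
      rintro w ⟨hw, hwt⟩
      rw [← hwt, re_add_im, hinj.leftInvOn_invFunOn hw, hre w hw]
    have hL₁ : w₁ ∈ L := ⟨h₁, rfl⟩
    have hL₂ : w₂ ∈ L := ⟨h₂, ht₂⟩
    refine hinj h₁ h₂ (Complex.ext ?_ ht₂.symm)
    refine hmono.injOn (mem_image_of_mem _ hL₁) (mem_image_of_mem _ hL₂) ?_
    rw [key _ hL₁, key _ hL₂, h]
  · have : {z | z ∈ F '' U ∧ z.im = t} = F '' {w | w ∈ U ∧ (Φ w).im = t} := by
      ext z
      constructor
      · rintro ⟨⟨w, hw, rfl⟩, hz⟩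
        exact ⟨w, ⟨hw, by rw [← him w hw, hz]⟩, rfl⟩
      · rintro ⟨w, ⟨hw, hz⟩, rfl⟩
        exact ⟨⟨w, hw, rfl⟩, by rw [him w hw, hz]⟩
    rw [this]
    exact (hlev t).image _ (hFc.mono fun w hw => hw.1)

/-- **Noshiro–Warschawski**, for a derivative with positive imaginary part. -/
theorem injOn_of_deriv_im_pos {U : Set ℂ} (hU : Convex ℝ U) {Φ Φ' : ℂ → ℂ}
    (hΦ : ∀ w ∈ U, HasDerivAt Φ (Φ' w) w) (hpos : ∀ w ∈ U, 0 < (Φ' w).im) : InjOn Φ U := by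
  intro w₁ h₁ w₂ h₂ h
  by_contra hne
  have hd : w₂ - w₁ ≠ 0 := sub_ne_zero.2 (Ne.symm hne)
  have hmem : ∀ x ∈ Icc (0 : ℝ) 1, w₁ + (x : ℂ) * (w₂ - w₁) ∈ U := fun x hx => by
    have := hU.add_smul_sub_mem h₁ h₂ hx
    rwa [real_smul] at this
  have hder : ∀ x ∈ Icc (0 : ℝ) 1,
      HasDerivAt (fun x : ℝ => (-I * (Φ (w₁ + (x : ℂ) * (w₂ - w₁)) / (w₂ - w₁))).re)
        (Φ' (w₁ + (x : ℂ) * (w₂ - w₁))).im x := fun x hx => by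
    have h3 : HasDerivAt (fun v : ℂ => w₁ + v * (w₂ - w₁)) (1 * (w₂ - w₁)) (x : ℂ) :=
      ((hasDerivAt_id _).mul_const _).const_add _
    have h4 := ((((hΦ _ (hmem x hx)).comp (x : ℂ) h3).div_const (w₂ - w₁)).const_mul
      (-I)).real_of_complex
    refine h4.congr_deriv ?_
    rw [one_mul, mul_div_assoc, div_self hd]
    simp
  have hmono := strictMonoOn_of_deriv_pos (convex_Icc (0 : ℝ) 1)
    (fun x hx => (hder x hx).continuousAt.continuousWithinAt)
    (fun x hx => by
      rw [(hder x (interior_subset hx)).deriv]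
      exact hpos _ (hmem x (interior_subset hx)))
  have := hmono (left_mem_Icc.2 zero_le_one) (right_mem_Icc.2 zero_le_one) zero_lt_one
  simp [h] at this

/-- The level sets of `Im Φ` in the horizontal strip `a < Im w < b` are connected if `Im Φ'` is
bounded below by a positive constant on each horizontal line. -/
theorem isPreconnected_level_strip {a b : ℝ} {Φ Φ' : ℂ → ℂ} {m : ℝ → ℝ}
    (hΦ : ∀ w, w.im ∈ Ioo a b → HasDerivAt Φ (Φ' w) w)
    (hm : ∀ y ∈ Ioo a b, 0 < m y) (hpos : ∀ w, w.im ∈ Ioo a b → m w.im ≤ (Φ' w).im) (t : ℝ) :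
    IsPreconnected {w | w.im ∈ Ioo a b ∧ (Φ w).im = t} := by
  have hmem : ∀ y ∈ Ioo a b, ∀ x : ℝ, ((x : ℂ) + y * I).im ∈ Ioo a b := by simp
  have hder : ∀ y ∈ Ioo a b, ∀ x : ℝ, HasDerivAt (fun x : ℝ => (Φ ((x : ℂ) + y * I)).im)
      (Φ' ((x : ℂ) + y * I)).im x := fun y hy x => by
    have h3 : HasDerivAt (fun v : ℂ => v + y * I) 1 (x : ℂ) := (hasDerivAt_id _).add_const _
    have h4 := (((hΦ _ (hmem y hy x)).comp (x : ℂ) h3).const_mul (-I)).real_of_complex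
    simpa using h4
  have hmono : ∀ y ∈ Ioo a b, StrictMono fun x : ℝ => (Φ ((x : ℂ) + y * I)).im := fun y hy =>
    strictMono_of_hasDerivAt_pos (hder y hy) fun x => by
      have h := hpos _ (hmem y hy x)
      have e : ((x : ℂ) + y * I).im = y := by simp
      rw [e] at h
      exact (hm y hy).trans_le h
  have hgrow : ∀ y ∈ Ioo a b, ∀ x₁ x₂ : ℝ, x₁ ≤ x₂ → m y * (x₂ - x₁) ≤
      (Φ ((x₂ : ℂ) + y * I)).im - (Φ ((x₁ : ℂ) + y * I)).im := fun y hy x₁ x₂ h => by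
    refine mul_sub_le_image_sub_of_le_deriv (fun x => (hder y hy x).differentiableAt)
      (fun x => ?_) h
    rw [(hder y hy x).deriv]
    simpa using hpos _ (hmem y hy x)
  have hsurj : ∀ y ∈ Ioo a b, ∃ x : ℝ, (Φ ((x : ℂ) + y * I)).im = t := fun y hy => by
    set c := (Φ (((0 : ℝ) : ℂ) + y * I)).im with hc
    have hm' := hm y hy
    set M := |t - c| / m y with hM
    have hM0 : 0 ≤ M := by positivity
    have e : m y * M = |t - c| := by rw [hM]; field_simp
    have h1 := hgrow y hy 0 M hM0
    have h2 := hgrow y hy (-M) 0 (by linarith)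
    rw [← hc, sub_zero, e] at h1
    rw [← hc, sub_neg_eq_add, zero_add, e] at h2
    have hcont : Continuous fun x : ℝ => (Φ ((x : ℂ) + y * I)).im :=
      continuous_iff_continuousAt.2 fun x => (hder y hy x).continuousAt
    obtain ⟨x, -, hx⟩ := intermediate_value_Icc (show -M ≤ M by linarith) hcont.continuousOn
      (show t ∈ Icc _ _ from ⟨by linarith [neg_abs_le (t - c)], by linarith [le_abs_self (t - c)]⟩)
    exact ⟨x, hx⟩
  choose! X hX using hsurj
  have hXc : ContinuousOn X (Ioo a b) := by
    intro y hy
    have hvert : ∀ x : ℝ, ContinuousAt (fun y : ℝ => (Φ ((x : ℂ) + y * I)).im) y := fun x =>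
      continuous_im.continuousAt.comp (ContinuousAt.comp (f := fun y : ℝ => (x : ℂ) + y * I)
        (hΦ _ (hmem y hy x)).continuousAt (by fun_prop))
    refine ContinuousAt.continuousWithinAt (tendsto_order.2 ⟨fun l hl => ?_, fun u hu => ?_⟩)
    · have h1 : (Φ ((l : ℂ) + y * I)).im < t := by rw [← hX y hy]; exact hmono y hy hl
      filter_upwards [(hvert l).eventually (gt_mem_nhds h1), isOpen_Ioo.mem_nhds hy] with y' h2 hy'
      rw [← hX y' hy'] at h2
      exact (hmono y' hy').lt_iff_lt.1 h2
    · have h1 : t < (Φ ((u : ℂ) + y * I)).im := by rw [← hX y hy]; exact hmono y hy hu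
      filter_upwards [(hvert u).eventually (lt_mem_nhds h1), isOpen_Ioo.mem_nhds hy] with y' h2 hy'
      rw [← hX y' hy'] at h2
      exact (hmono y' hy').lt_iff_lt.1 h2
  have himage : {w | w.im ∈ Ioo a b ∧ (Φ w).im = t} =
      (fun y : ℝ => (X y : ℂ) + y * I) '' Ioo a b := by
    ext w
    constructor
    · rintro ⟨hw, hwt⟩
      refine ⟨w.im, hw, ?_⟩
      have : X w.im = w.re := by
        apply (hmono _ hw).injective
        simp only
        rw [hX _ hw, re_add_im, hwt]
      simp only
      rw [this, re_add_im]
    · rintro ⟨y, hy, rfl⟩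
      exact ⟨hmem y hy _, hX y hy⟩
  rw [himage]
  refine isPreconnected_Ioo.image _ ?_
  exact (continuous_ofReal.comp_continuousOn hXc).add (by fun_prop)

/-- The integral along segments from `0` is a primitive of a holomorphic function on the disk. -/
theorem hasDerivAt_segInt {f : ℂ → ℂ} (hf : DifferentiableOn ℂ f unitDisk) {z : ℂ}
    (hz : z ∈ unitDisk) : HasDerivAt (segInt f) (f z) z := by
  obtain ⟨G, hG⟩ := DifferentiableOn.isExactOn_ball hf
  have key : ∀ w ∈ unitDisk, segInt f w = G w - G 0 := fun w hw => by
    have hmem : ∀ t ∈ Icc (0 : ℝ) 1, (t : ℂ) * w ∈ unitDisk := fun t ht => by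
      simp only [unitDisk, mem_ball_zero_iff, norm_mul, norm_real, Real.norm_eq_abs,
        abs_of_nonneg ht.1] at hw ⊢
      nlinarith [norm_nonneg w, ht.1, ht.2]
    have h := intervalIntegral.integral_eq_sub_of_hasDerivAt (a := 0) (b := 1)
      (f := fun t : ℝ => G ((t : ℂ) * w)) (f' := fun t : ℝ => w * f ((t : ℂ) * w)) ?_ ?_
    · simpa [segInt] using h
    · intro t ht
      rw [uIcc_of_le zero_le_one] at ht
      have h3 : HasDerivAt (fun v : ℂ => v * w) (1 * w) (t : ℂ) := (hasDerivAt_id _).mul_const _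
      have := ((hG _ (hmem t ht)).comp (t : ℂ) h3).comp_ofReal
      exact this.congr_deriv (by ring)
    · refine ContinuousOn.intervalIntegrable ?_
      rw [uIcc_of_le zero_le_one]
      exact continuousOn_const.mul (hf.continuousOn.comp (by fun_prop) hmem)
  refine ((hG z hz).sub_const (G 0)).congr_of_eventuallyEq ?_
  exact eventually_of_mem (Metric.isOpen_ball.mem_nhds hz) key

theorem sq_sub_one_ne_zero_of_im_pos {u : ℂ} (hu : 0 < u.im) : u ^ 2 - 1 ≠ 0 := fun h => by
  rcases eq_or_eq_neg_of_sq_eq_sq u 1 (by rw [one_pow, sub_eq_zero.1 h]) with h | h <;>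
    simp [h] at hu

theorem re_one_add_div_one_sub_pos {u : ℂ} (hu : ‖u‖ < 1) : 0 < ((1 + u) / (1 - u)).re := by
  have h1 : 1 - u ≠ 0 := fun h => by
    rw [← sub_eq_zero.1 h, norm_one] at hu
    exact hu.ne rfl
  have h6 : normSq u < 1 := by
    rw [← Complex.sq_norm]
    exact pow_lt_one₀ (norm_nonneg u) hu two_ne_zero
  have h7 : ((1 + u) / (1 - u)).re = (1 - normSq u) / normSq (1 - u) := by
    rw [div_re, ← add_div]
    congr 1
    simp only [normSq_apply, add_re, add_im, sub_re, sub_im, one_re, one_im]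
    ring
  rw [h7]
  exact div_pos (by linarith) (normSq_pos.2 h1)

theorem norm_moebius_lt_one {E Q : ℂ} (hE : ‖E‖ = 1) (hE' : 0 < E.im) (hQ : 0 < Q.im) :
    ‖(1 + E * Q) / (E + Q)‖ < 1 := by
  have hne : E + Q ≠ 0 := fun h => by
    have := congrArg im h
    simp at this
    linarith
  rw [norm_div, div_lt_one (norm_pos_iff.2 hne), ← sq_lt_sq₀ (norm_nonneg _) (norm_nonneg _),
    Complex.sq_norm, Complex.sq_norm]
  have h1 : normSq E = 1 := by rw [← Complex.sq_norm, hE, one_pow]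
  simp only [normSq_apply, add_re, add_im, mul_re, mul_im, one_re, one_im] at h1 ⊢
  have := mul_pos hE' hQ
  linear_combination 4 * this + (Q.re ^ 2 + Q.im ^ 2 - 1) * h1

theorem exists_moebius_exp_eq {E z : ℂ} (hE : ‖E‖ = 1) (hE' : 0 < E.im) (hz : ‖z‖ < 1) :
    ∃ w : ℂ, w.im ∈ Ioo 0 π ∧ (1 + E * exp w) / (E + exp w) = z := by
  have hne : E - z ≠ 0 := fun h => by
    rw [sub_eq_zero.1 h] at hE
    exact hz.ne hE
  have hE2 : E ^ 2 - 1 ≠ 0 := sq_sub_one_ne_zero_of_im_pos hE'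
  set Q := (E * z - 1) / (E - z) with hQ
  have hQim : 0 < Q.im := by
    have h1 : normSq E = 1 := by rw [← Complex.sq_norm, hE, one_pow]
    have h2 : normSq z < 1 := by
      rw [← Complex.sq_norm]
      exact pow_lt_one₀ (norm_nonneg z) hz two_ne_zero
    have h3 : Q.im = E.im * (1 - normSq z) / normSq (E - z) := by
      rw [hQ, div_im, ← sub_div]
      congr 1
      simp only [normSq_apply, sub_re, sub_im, mul_re, mul_im, one_re, one_im] at h1 ⊢
      linear_combination z.im * h1
    rw [h3]
    exact div_pos (mul_pos hE' (by linarith)) (normSq_pos.2 hne)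
  have hQ0 : Q ≠ 0 := fun h => by simp [h] at hQim
  refine ⟨log Q, ?_, ?_⟩
  · rw [log_im]
    refine ⟨?_, ?_⟩
    · refine lt_of_le_of_ne (arg_nonneg_iff.2 hQim.le) fun h => ?_
      exact hQim.ne' (arg_eq_zero_iff.1 h.symm).2
    · refine lt_of_le_of_ne (arg_le_pi _) fun h => ?_
      exact hQim.ne' (arg_eq_pi_iff.1 h).2
  · rw [exp_log hQ0]
    have h4 : E + Q ≠ 0 := fun h => by
      have := congrArg im h
      simp at this
      linarith
    rw [div_eq_iff h4, hQ]
    field_simp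
    ring

theorem hasDerivAt_log_add_koebe (A B : ℂ) {E z : ℂ} (hE : ‖E‖ = 1) (hz : ‖z‖ < 1) :
    HasDerivAt (fun z => A * log ((1 + z) / (1 - z)) + B * z / ((1 - E * z) * (1 - E⁻¹ * z)))
      (2 * A / (1 - z ^ 2) + B * (1 - z ^ 2) / ((1 - E * z) * (1 - E⁻¹ * z)) ^ 2) z := by
  have hne : ∀ u : ℂ, ‖u‖ < 1 → 1 - u ≠ 0 := fun u hu h => by
    rw [← sub_eq_zero.1 h, norm_one] at hu
    exact hu.ne rfl
  have hE0 : E ≠ 0 := fun h => by simp [h] at hE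
  have h1 : 1 - z ≠ 0 := hne z hz
  have h2 : 1 + z ≠ 0 := by simpa using hne (-z) (by simpa using hz)
  have h3 : 1 - E * z ≠ 0 := hne _ (by simpa [hE] using hz)
  have h4 : 1 - E⁻¹ * z ≠ 0 := hne _ (by simpa [hE] using hz)
  have h5 : 1 - z ^ 2 ≠ 0 := hne _ (by
    rw [norm_pow]; exact pow_lt_one₀ (norm_nonneg z) hz two_ne_zero)
  have hslit : (1 + z) / (1 - z) ∈ slitPlane := Or.inl (re_one_add_div_one_sub_pos hz)
  have d1 : HasDerivAt (fun z : ℂ => (1 + z) / (1 - z))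
      ((1 * (1 - z) - (1 + z) * (-1)) / (1 - z) ^ 2) z :=
    ((hasDerivAt_id z).const_add 1).div ((hasDerivAt_id z).const_sub 1) h1
  have d2 : HasDerivAt (fun z : ℂ => B * z / ((1 - E * z) * (1 - E⁻¹ * z)))
      ((B * 1 * ((1 - E * z) * (1 - E⁻¹ * z)) - B * z *
        ((-(E * 1)) * (1 - E⁻¹ * z) + (1 - E * z) * (-(E⁻¹ * 1)))) /
        ((1 - E * z) * (1 - E⁻¹ * z)) ^ 2) z :=
    ((hasDerivAt_id z).const_mul B).div
      ((((hasDerivAt_id z).const_mul E).const_sub 1).mul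
        (((hasDerivAt_id z).const_mul E⁻¹).const_sub 1)) (mul_ne_zero h3 h4)
  refine (((d1.clog hslit).const_mul A).add d2).congr_deriv ?_
  congr 1
  · have : (1 - z ^ 2) = (1 - z) * (1 + z) := by ring
    rw [this]
    field_simp
    ring
  · congr 1
    linear_combination (-B * z ^ 2) * mul_inv_cancel₀ hE0

theorem hasDerivAt_moebius_exp {E w : ℂ} (h : E + exp w ≠ 0) :
    HasDerivAt (fun w => (1 + E * exp w) / (E + exp w))
      (exp w * (E ^ 2 - 1) / (E + exp w) ^ 2) w := by
  have := (((hasDerivAt_exp w).const_mul E).const_add 1).div ((hasDerivAt_exp w).const_add E) h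
  refine this.congr_deriv ?_
  congr 1
  ring

theorem deriv_log_add_koebe_moebius (A B : ℂ) {E Q z : ℂ} (hE : E ≠ 0) (hQ : Q ≠ 0)
    (hEQ : E + Q ≠ 0) (hE2 : E ^ 2 - 1 ≠ 0) (hQ2 : Q ^ 2 - 1 ≠ 0)
    (hz : z = (1 + E * Q) / (E + Q)) :
    (2 * A / (1 - z ^ 2) + B * (1 - z ^ 2) / ((1 - E * z) * (1 - E⁻¹ * z)) ^ 2) *
      (Q * (E ^ 2 - 1) / (E + Q) ^ 2) =
      -(2 * A) / (Q - Q⁻¹) - B * (Q - Q⁻¹) / (E - E⁻¹) ^ 2 := by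
  have e1 : 1 - z ^ 2 = -((E ^ 2 - 1) * (Q ^ 2 - 1)) / (E + Q) ^ 2 := by
    rw [hz]; field_simp; ring
  have e2 : (1 - E * z) * (1 - E⁻¹ * z) = -(Q * (E ^ 2 - 1) ^ 2) / (E * (E + Q) ^ 2) := by
    rw [hz]; field_simp; ring
  have e3 : Q - Q⁻¹ = (Q ^ 2 - 1) / Q := by field_simp
  have e4 : E - E⁻¹ = (E ^ 2 - 1) / E := by field_simp
  rw [e1, e2, e3, e4]
  field_simp
  ring

theorem im_exp_sub_exp_neg (w : ℂ) :
    (exp w - (exp w)⁻¹).im = (Real.exp w.re + Real.exp (-w.re)) * Real.sin w.im := by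
  rw [← exp_neg, sub_im, exp_im, exp_im]
  simp
  ring

theorem sin_le_im_exp_sub_exp_neg {w : ℂ} (hw : w.im ∈ Ioo 0 π) :
    Real.sin w.im ≤ (exp w - (exp w)⁻¹).im := by
  rw [im_exp_sub_exp_neg]
  have := Real.sin_pos_of_mem_Ioo hw
  nlinarith [Real.add_one_le_exp w.re, Real.add_one_le_exp (-w.re)]

theorem slit_mapping_shear_univalent_CHD
    (A B : ℝ) (hA : 0 < A) (hB : 0 < B)
    (γ : ℝ) (hγ : γ ∈ Set.Ioo 0 Real.pi) (n : ℕ) (hn : 0 < n) :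
    let φ : ℂ → ℂ := fun z =>
      (A : ℂ) * Complex.log ((1 + z) / (1 - z)) +
        (B : ℂ) * z / ((1 - Complex.exp (Complex.I * γ) * z) *
          (1 - Complex.exp (-(Complex.I * γ)) * z))
    let f : ℂ → ℂ := fun z =>
      2 * (((segInt (fun ζ => deriv φ ζ / (1 - ζ ^ n)) z).re : ℝ) : ℂ) -
        (starRingEnd ℂ) (φ z)
    Set.InjOn f unitDisk ∧ IsCHD (f '' unitDisk) := by
  intro φ f
  set E : ℂ := exp (I * γ) with hEdef
  have hEnorm : ‖E‖ = 1 := by rw [hEdef, mul_comm, norm_exp_ofReal_mul_I]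
  have hE0 : E ≠ 0 := exp_ne_zero _
  have hEim' : E.im = Real.sin γ := by rw [hEdef, mul_comm, exp_ofReal_mul_I_im]
  have hsin : 0 < Real.sin γ := Real.sin_pos_of_mem_Ioo hγ
  have hEim : 0 < E.im := hEim' ▸ hsin
  have hE2 : E ^ 2 - 1 ≠ 0 := sq_sub_one_ne_zero_of_im_pos hEim
  have hEE : (E - E⁻¹) ^ 2 = ((-(4 * Real.sin γ ^ 2) : ℝ) : ℂ) := by
    have : E - E⁻¹ = 2 * Real.sin γ * I := by
      rw [inv_def, normSq_eq_norm_sq, hEnorm, ← hEim']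
      apply Complex.ext <;> simp
      ring
    rw [this, mul_pow, I_sq]
    push_cast
    ring
  have hφ : ∀ z ∈ unitDisk, HasDerivAt φ
      (2 * A / (1 - z ^ 2) + B * (1 - z ^ 2) / ((1 - E * z) * (1 - E⁻¹ * z)) ^ 2) z := by
    intro z hz
    have hφE : φ = fun z => A * log ((1 + z) / (1 - z)) +
        B * z / ((1 - E * z) * (1 - E⁻¹ * z)) := by
      simp only [φ, hEdef, exp_neg]
    rw [hφE]
    exact hasDerivAt_log_add_koebe A B hEnorm (mem_ball_zero_iff.1 hz)
  have hdisk : ∀ z ∈ unitDisk, ‖z ^ n‖ < 1 := fun z hz => by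
    rw [norm_pow]
    exact pow_lt_one₀ (norm_nonneg z) (mem_ball_zero_iff.1 hz) hn.ne'
  have hpow : ∀ z ∈ unitDisk, 1 - z ^ n ≠ 0 := fun z hz h => by
    have := hdisk z hz
    rw [← sub_eq_zero.1 h, norm_one] at this
    exact this.ne rfl
  have hφd : DifferentiableOn ℂ φ unitDisk := fun z hz =>
    (hφ z hz).differentiableAt.differentiableWithinAt
  have hint : DifferentiableOn ℂ (fun ζ => deriv φ ζ / (1 - ζ ^ n)) unitDisk :=
    (hφd.deriv Metric.isOpen_ball).div (by fun_prop) hpow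
  set U : Set ℂ := {w | w.im ∈ Ioo 0 π} with hUdef
  set ψ : ℂ → ℂ := fun w => (1 + E * exp w) / (E + exp w) with hψdef
  have hexp : ∀ w ∈ U, 0 < (exp w).im := fun w hw => by
    rw [exp_im]
    exact mul_pos (Real.exp_pos _) (Real.sin_pos_of_mem_Ioo hw)
  have hψmem : ∀ w ∈ U, ψ w ∈ unitDisk := fun w hw =>
    mem_ball_zero_iff.2 (norm_moebius_lt_one hEnorm hEim (hexp w hw))
  have hψimage : ψ '' U = unitDisk := by
    refine Subset.antisymm (image_subset_iff.2 hψmem) fun z hz => ?_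
    exact exists_moebius_exp_eq hEnorm hEim (mem_ball_zero_iff.1 hz)
  have hEQ : ∀ w ∈ U, E + exp w ≠ 0 := fun w hw h => by
    have h1 := congrArg im h
    have h2 := hexp w hw
    rw [add_im, zero_im] at h1
    linarith
  have hψ : ∀ w ∈ U, HasDerivAt ψ (exp w * (E ^ 2 - 1) / (E + exp w) ^ 2) w := fun w hw =>
    hasDerivAt_moebius_exp (hEQ w hw)
  set k : ℝ := B / (4 * Real.sin γ ^ 2) with hk
  have hk0 : 0 < k := by positivity
  set Φ' : ℂ → ℂ := fun w =>
    -(2 * A) / (exp w - (exp w)⁻¹) + k * (exp w - (exp w)⁻¹) with hΦ'def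
  have hchain : ∀ w ∈ U, (2 * A / (1 - ψ w ^ 2) +
      B * (1 - ψ w ^ 2) / ((1 - E * ψ w) * (1 - E⁻¹ * ψ w)) ^ 2) *
      (exp w * (E ^ 2 - 1) / (E + exp w) ^ 2) = Φ' w := fun w hw => by
    have hQ2 : exp w ^ 2 - 1 ≠ 0 := sq_sub_one_ne_zero_of_im_pos (hexp w hw)
    rw [deriv_log_add_koebe_moebius A B hE0 (exp_ne_zero w) (hEQ w hw) hE2 hQ2 rfl, hEE, hΦ'def,
      hk]
    push_cast
    rw [sub_eq_add_neg, div_neg, neg_neg]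
    ring
  have hΦ : ∀ w ∈ U, HasDerivAt (φ ∘ ψ) (Φ' w) w := fun w hw => by
    rw [← hchain w hw]
    exact (hφ _ (hψmem w hw)).comp w (hψ w hw)
  have hΦ'im : ∀ w ∈ U, k * Real.sin w.im ≤ (Φ' w).im := fun w hw => by
    have h1 := sin_le_im_exp_sub_exp_neg hw
    have h2 := Real.sin_pos_of_mem_Ioo hw
    simp only [hΦ'def]
    set s := exp w - (exp w)⁻¹
    have h3 : (-(2 * A) / s + k * s : ℂ).im = 2 * A * s.im / normSq s + k * s.im := by
      rw [add_im, im_ofReal_mul, div_im]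
      simp
      ring
    rw [h3]
    have h4 : 0 ≤ 2 * A * s.im / normSq s :=
      div_nonneg (by nlinarith) (normSq_nonneg s)
    nlinarith
  have hΦ'pos : ∀ w ∈ U, 0 < (Φ' w).im := fun w hw =>
    (mul_pos hk0 (Real.sin_pos_of_mem_Ioo hw)).trans_le (hΦ'im w hw)
  have hUopen : IsOpen U := isOpen_Ioo.preimage continuous_im
  have hUconv : Convex ℝ U := (convex_Ioo (0 : ℝ) π).linear_preimage imLm
  set h : ℂ → ℂ := segInt fun ζ => deriv φ ζ / (1 - ζ ^ n) 
  obtain ⟨hinj, hCHD⟩ := injOn_and_isCHD_of_shear (F := f ∘ ψ)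
    (H := fun w => 2 * h (ψ w) - φ (ψ w))
    (P := fun w => (1 + ψ w ^ n) / (1 - ψ w ^ n)) hUopen hΦ
    (fun w hw h0 => (hΦ'pos w hw).ne' (by rw [h0, zero_im]))
    (fun w hw => by
      have h1 := (hasDerivAt_segInt hint (hψmem w hw)).comp w (hψ w hw)
      refine ((h1.const_mul 2).sub (hΦ w hw)).congr_deriv ?_
      have h2 := hpow _ (hψmem w hw)
      rw [← hchain w hw, (hφ _ (hψmem w hw)).deriv]
      generalize 2 * (A : ℂ) / (1 - ψ w ^ 2) + _ = a
      generalize exp w * (E ^ 2 - 1) / (E + exp w) ^ 2 = b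
      field_simp
      ring)
    (fun w hw => re_one_add_div_one_sub_pos (hdisk _ (hψmem w hw)))
    (injOn_of_deriv_im_pos hUconv hΦ hΦ'pos)
    (isPreconnected_level_strip (m := fun y => k * Real.sin y) hΦ
      (fun y hy => mul_pos hk0 (Real.sin_pos_of_mem_Ioo hy)) hΦ'im)
    (fun w _ => by simp [f, h])
    (fun w _ => by simp [f])
  rw [← hψimage]
  refine ⟨hinj.image_of_comp, ?_⟩
  rwa [image_comp] at hCHD
end
end
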